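/- Suppose F is immersed in G under P, and let Q be a probability measure equivalent to P on 𝒢 whose density ρ = dQ/dP is F_∞-measurable. Then F is immersed in G under Q, i.e. every (F,Q)-martingale is a (G,Q)-martingale. -/

import Mathlib

open MeasureTheory Set
open scoped NNReal ENNReal

noncomputable section

namespace DefaultTimes

variable {Ω : Type*}

/-- The progressively enlarged filtration
`G_t = ⋂_{u>t} (F_u ∨ σ(τ ∧ s : s ≤ u))`. -/
def enlargedFiltration {m0 : MeasurableSpace Ω}
    (F : Filtration ℝ≥0 m0) (τ : Ω → ℝ≥0∞) (hτ : Measurable τ) :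
    Filtration ℝ≥0 m0 where
  seq t := ⨅ u ∈ Set.Ioi t, (F u ⊔ ⨆ s ∈ Set.Iic u,
      MeasurableSpace.comap (fun ω => min (τ ω) (s : ℝ≥0∞)) inferInstance)
  mono' := fun i j hij => le_iInf₂ fun u hu => iInf₂_le u (lt_of_le_of_lt hij hu)
  le' := fun t => by
    refine le_trans (iInf₂_le (t + 1) (lt_add_of_pos_right t one_pos)) ?_
    exact sup_le (Filtration.le _ _)
      (iSup₂_le fun s _ => Measurable.comap_le (hτ.min measurable_const))

/-- `F` is immersed in `G` under `μ` ((H)-hypothesis): every `(F,μ)`-martingale is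
a `(G,μ)`-martingale. -/
def Immersion {m0 : MeasurableSpace Ω} (F G : Filtration ℝ≥0 m0) (μ : Measure Ω) : Prop :=
  ∀ f : ℝ≥0 → Ω → ℝ, Martingale f F μ → Martingale f G μ

lemma le_enlargedFiltration {m0 : MeasurableSpace Ω}
    (F : Filtration ℝ≥0 m0) (τ : Ω → ℝ≥0∞) (hτ : Measurable τ) :
    F ≤ enlargedFiltration F τ hτ := fun _ =>
  le_iInf₂ fun _ hu => (F.mono (le_of_lt hu)).trans le_sup_left

/-- Under immersion, conditioning an `F_∞`-measurable variable on `G_s` or on `F_s` is the same: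
the two variables have the same integral over every event of `G_s`. -/
lemma Immersion.setIntegral_condExp {m0 : MeasurableSpace Ω} {μ : Measure Ω} [IsFiniteMeasure μ]
    {F G : Filtration ℝ≥0 m0} (h : Immersion F G μ) {X : Ω → ℝ} (hX : Integrable X μ)
    (hXm : StronglyMeasurable[⨆ u, F u] X) {s : ℝ≥0} {A : Set Ω} (hA : MeasurableSet[G s] A) :
    ∫ ω in A, (μ[X | F s]) ω ∂μ = ∫ ω in A, X ω ∂μ := by
  let F' : Filtration ℕ m0 :=
    { seq := fun n => F n
      mono' := fun _ _ hij => F.mono (Nat.cast_le.2 hij)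
      le' := fun n => F.le n }
  have hsup : ⨆ u, F u ≤ ⨆ n, F' n := iSup_le fun u => by
    obtain ⟨n, hn⟩ := exists_nat_ge u
    exact (F.mono hn).trans (le_iSup (fun n => F' n) n)
  have hlim := tendsto_setIntegral_of_L1' X hX.aestronglyMeasurable
    (Filter.Eventually.of_forall fun n => integrable_condExp (m := F' n))
    (hX.tendsto_eLpNorm_condExp (hXm.mono hsup)) A
  obtain ⟨N, hN⟩ := exists_nat_ge s
  refine tendsto_nhds_unique (tendsto_const_nhds.congr' ?_) hlim
  filter_upwards [Filter.eventually_ge_atTop N] with n hn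
  exact (h _ (martingale_condExp X F μ)).setIntegral_eq (hN.trans (Nat.cast_le.2 hn)) hA

/-- Immersion is preserved by a change of measure whose density is `F_∞`-measurable. -/
lemma Immersion.withDensity {m0 : MeasurableSpace Ω} {μ : Measure Ω} [IsFiniteMeasure μ]
    {F G : Filtration ℝ≥0 m0} (hFG : F ≤ G) (h : Immersion F G μ) {ρ : Ω → ℝ}
    (hρ_meas : Measurable[⨆ u, F u] ρ) (hρ_nonneg : ∀ ω, 0 ≤ ρ ω) (hρ_int : Integrable ρ μ) :
    Immersion F G (μ.withDensity fun ω => ENNReal.ofReal (ρ ω)) := by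
  intro f hf
  have : IsFiniteMeasure (μ.withDensity fun ω => ENNReal.ofReal (ρ ω)) :=
    isFiniteMeasure_withDensity_ofReal hρ_int.2
  set Q := μ.withDensity fun ω => ENNReal.ofReal (ρ ω) with hQ
  have hρm : Measurable fun ω => ENNReal.ofReal (ρ ω) :=
    (hρ_meas.mono (iSup_le F.le) le_rfl).ennreal_ofReal
  have hint (t : ℝ≥0) : Integrable (fun ω => ρ ω * f t ω) μ := by
    have := (integrable_withDensity_iff_integrable_smul' hρm
      (Filter.Eventually.of_forall fun _ => ENNReal.ofReal_lt_top)).1 (hf.integrable t)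
    simpa only [ENNReal.toReal_ofReal (hρ_nonneg _), smul_eq_mul] using this
  have hset (t : ℝ≥0) {A : Set Ω} (hA : MeasurableSet A) :
      ∫ ω in A, f t ω ∂Q = ∫ ω in A, ρ ω * f t ω ∂μ := by
    rw [hQ, restrict_withDensity hA, integral_withDensity_eq_integral_toReal_smul hρm
      (Filter.Eventually.of_forall fun _ => ENNReal.ofReal_lt_top)]
    simp only [ENNReal.toReal_ofReal (hρ_nonneg _), smul_eq_mul]
  have hmeas (t : ℝ≥0) : StronglyMeasurable[⨆ u, F u] fun ω => ρ ω * f t ω :=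
    hρ_meas.stronglyMeasurable.mul ((hf.1 t).mono (le_iSup (fun u => F u) t))
  refine ⟨fun t => (hf.1 t).mono (hFG t), fun s t hst => ?_⟩
  have hcond : μ[fun ω => ρ ω * f s ω | F s] =ᵐ[μ] μ[fun ω => ρ ω * f t ω | F s] := by
    refine ae_eq_condExp_of_forall_setIntegral_eq (F.le s) (hint t)
      (fun _ _ _ => integrable_condExp.integrableOn) (fun B hB _ => ?_)
      stronglyMeasurable_condExp.aestronglyMeasurable
    rw [MeasureTheory.setIntegral_condExp (F.le s) (hint s) hB, ← hset s (F.le s B hB),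
      ← hset t (F.le s B hB), hf.setIntegral_eq hst hB]
  symm
  refine ae_eq_condExp_of_forall_setIntegral_eq (G.le s) (hf.integrable t)
    (fun _ _ _ => (hf.integrable s).integrableOn) (fun A hA _ => ?_)
    ((hf.1 s).mono (hFG s)).aestronglyMeasurable
  rw [hset s (G.le s A hA), hset t (G.le s A hA), ← h.setIntegral_condExp (hint s) (hmeas s) hA,
    ← h.setIntegral_condExp (hint t) (hmeas t) hA]
  exact integral_congr_ae (ae_restrict_of_ae hcond)

theorem stmt_5 {m0 : MeasurableSpace Ω} (P : Measure Ω) [IsProbabilityMeasure P]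
    (F : Filtration ℝ≥0 m0) (τ : Ω → ℝ≥0∞) (hτ : Measurable τ)
    (hImm : Immersion F (enlargedFiltration F τ hτ) P)
    (ρ : Ω → ℝ) (hρ_meas : Measurable[⨆ u, F u] ρ) (hρ_pos : ∀ ω, 0 < ρ ω)
    (hρ_int : Integrable ρ P) (hρ_one : ∫ ω, ρ ω ∂P = 1)
    (Q : Measure Ω) (hQ : Q = P.withDensity fun ω => ENNReal.ofReal (ρ ω)) :
    Immersion F (enlargedFiltration F τ hτ) Q := by
  subst hQ
  exact hImm.withDensity (le_enlargedFiltration F τ hτ) hρ_meas (fun ω => (hρ_pos ω).le) hρ_int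

end DefaultTimes
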